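/- Let (A, H, φ, ψ, ρ, γ) be a matched pair of anti-flexible coalgebras. Define on E = A⊕H the comultiplication Δ_E(a) = Δ_A(a) + φ(a) + ψ(a) for a in A and Δ_E(x) = Δ_H(x) + ρ(x) + γ(x) for x in H. Then (E, Δ_E) is an anti-flexible coalgebra (the bicrossed coproduct of A and H). -/

import Mathlib

open TensorProduct LinearMap

namespace AntiFlexible

section Basic

variable (K : Type*) [Field K] [CharZero K]
variable (M N P : Type*)
variable [AddCommGroup M] [Module K M] [AddCommGroup N] [Module K N] [AddCommGroup P] [Module K P]

/-- The flip map `τ : M ⊗ N → N ⊗ M`. -/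
noncomputable def τ : M ⊗[K] N →ₗ[K] N ⊗[K] M := (TensorProduct.comm K M N).toLinearMap

/-- `τ₁₃ : (M ⊗ N) ⊗ P → (P ⊗ N) ⊗ M`, exchanging the outer tensor factors. -/
noncomputable def τ₁₃ : (M ⊗[K] N) ⊗[K] P →ₗ[K] (P ⊗[K] N) ⊗[K] M :=
  (TensorProduct.assoc K P N M).symm.toLinearMap ∘ₗ
    (lTensor P (τ K M N)) ∘ₗ (TensorProduct.comm K (M ⊗[K] N) P).toLinearMap

/-- The reassociator `M ⊗ (N ⊗ P) → (M ⊗ N) ⊗ P`. -/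
noncomputable def α : M ⊗[K] (N ⊗[K] P) →ₗ[K] (M ⊗[K] N) ⊗[K] P :=
  (TensorProduct.assoc K M N P).symm.toLinearMap

/-- The antisymmetrizer `id - τ` on `M ⊗ M`. -/
noncomputable def ω : M ⊗[K] M →ₗ[K] M ⊗[K] M := LinearMap.id - τ K M M

end Basic

section Structures

variable {K : Type*} [Field K] [CharZero K]
variable {A H V : Type*}
variable [AddCommGroup A] [Module K A] [AddCommGroup H] [Module K H]
variable [AddCommGroup V] [Module K V]

/-- Anti-flexible algebra: `(ab)c - a(bc) = (cb)a - c(ba)`. -/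
def IsAFAlgebra (m : A →ₗ[K] A →ₗ[K] A) : Prop :=
  ∀ a b c, m (m a b) c - m a (m b c) = m (m c b) a - m c (m b a)

/-- The coassociativity defect `(Δ ⊗ id)Δ - (id ⊗ Δ)Δ`, viewed in `(A ⊗ A) ⊗ A`. -/
noncomputable def coassocDefect (Δ : A →ₗ[K] A ⊗[K] A) : A →ₗ[K] (A ⊗[K] A) ⊗[K] A :=
  (rTensor A Δ) ∘ₗ Δ - (α K A A A) ∘ₗ (lTensor A Δ) ∘ₗ Δ

/-- Anti-flexible coalgebra: the coassociativity defect is `τ₁₃`-invariant. -/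
def IsAFCoalgebra (Δ : A →ₗ[K] A ⊗[K] A) : Prop :=
  ∀ a, coassocDefect Δ a = τ₁₃ K A A A (coassocDefect Δ a)

/-- Anti-flexible bialgebra. -/
def IsAFBialgebra (m : A →ₗ[K] A →ₗ[K] A) (Δ : A →ₗ[K] A ⊗[K] A) : Prop :=
  IsAFAlgebra m ∧ IsAFCoalgebra Δ ∧
  (∀ a b, Δ (m a b) + τ K A A (Δ (m b a)) =
      rTensor A (m b) (τ K A A (Δ a)) + lTensor A (m.flip a) (τ K A A (Δ b))
      + rTensor A (m.flip b) (Δ a) + lTensor A (m a) (Δ b)) ∧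
  (∀ a b, ω K A (lTensor A (m.flip b) (Δ a) - rTensor A (m b) (Δ a)
      - lTensor A (m.flip a) (Δ b) + rTensor A (m a) (Δ b)) = 0)

/-- `V` is a bimodule over the anti-flexible algebra `(H, m)` via `tr = ▷` and `tl = ◁`. -/
def IsAFBimodule (m : H →ₗ[K] H →ₗ[K] H)
    (tr : H →ₗ[K] V →ₗ[K] V) (tl : V →ₗ[K] H →ₗ[K] V) : Prop :=
  (∀ x y v, tr (m x y) v - tr x (tr y v) = tl (tl v y) x - tl v (m y x)) ∧
  (∀ x y v, tl (tr x v) y - tr x (tl v y) = tl (tr y v) x - tr y (tl v x))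

/-- `V` is a bicomodule over the anti-flexible coalgebra `(H, Δ)` via `φ` and `ψ`. -/
def IsAFBicomodule (Δ : H →ₗ[K] H ⊗[K] H)
    (φ : V →ₗ[K] H ⊗[K] V) (ψ : V →ₗ[K] V ⊗[K] H) : Prop :=
  (∀ v, rTensor V Δ (φ v) - α K H H V (lTensor H φ (φ v))
      = τ₁₃ K V H H (rTensor H ψ (ψ v) - α K V H H (lTensor V Δ (ψ v)))) ∧
  (∀ v, rTensor H φ (ψ v) - α K H V H (lTensor H ψ (φ v))
      = τ₁₃ K H V H (rTensor H φ (ψ v) - α K H V H (lTensor H ψ (φ v))))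

/-- Anti-flexible Hopf bimodule over `(H, m, Δ)`, with conditions (HM1)-(HM3). -/
def IsAFHopfBimodule (m : H →ₗ[K] H →ₗ[K] H) (Δ : H →ₗ[K] H ⊗[K] H)
    (tr : H →ₗ[K] V →ₗ[K] V) (tl : V →ₗ[K] H →ₗ[K] V)
    (φ : V →ₗ[K] H ⊗[K] V) (ψ : V →ₗ[K] V ⊗[K] H) : Prop :=
  IsAFBimodule m tr tl ∧ IsAFBicomodule Δ φ ψ ∧
  -- (HM1)
  (∀ x v, φ (tr x v) + τ K V H (ψ (tl v x))
      = lTensor H (tr x) (φ v) + lTensor H (tl.flip x) (τ K V H (ψ v))) ∧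
  -- (HM2)
  (∀ x v, ψ (tr x v) + τ K H V (φ (tl v x))
      = rTensor H (tr.flip v) (Δ x) + lTensor V (m x) (ψ v)
      + lTensor V (m.flip x) (τ K H V (φ v)) + rTensor H (tl v) (τ K H H (Δ x))) ∧
  -- (HM3)
  (∀ x v, rTensor H (tr x) (ψ v) - rTensor H (tl v) (Δ x) - lTensor V (m.flip x) (ψ v)
      = τ K H V (- lTensor H (tl.flip x) (φ v) + rTensor V (m x) (φ v)
        + lTensor H (tr.flip v) (Δ x)))

/-- `A` is a braided anti-flexible bialgebra over `(H, mH, ΔH)`: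
an anti-flexible algebra and coalgebra in the category of anti-flexible Hopf bimodules,
satisfying (BB1) and (BB2). -/
def IsBraidedAFBialgebra (mA : A →ₗ[K] A →ₗ[K] A) (ΔA : A →ₗ[K] A ⊗[K] A)
    (mH : H →ₗ[K] H →ₗ[K] H) (ΔH : H →ₗ[K] H ⊗[K] H)
    (tr : H →ₗ[K] A →ₗ[K] A) (tl : A →ₗ[K] H →ₗ[K] A)
    (φ : A →ₗ[K] H ⊗[K] A) (ψ : A →ₗ[K] A ⊗[K] H) : Prop :=
  IsAFAlgebra mA ∧ IsAFCoalgebra ΔA ∧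
  IsAFHopfBimodule mH ΔH tr tl φ ψ ∧
  -- H-bimodule algebra
  (∀ x a b, mA (tr x a) b - tr x (mA a b) = tl (mA b a) x - mA b (tl a x)) ∧
  (∀ x a b, mA a (tr x b) - mA (tl a x) b = mA b (tr x a) - mA (tl b x) a) ∧
  -- H-bimodule coalgebra
  (∀ x b, ΔA (tr x b) + τ K A A (ΔA (tl b x))
      = lTensor A (tl.flip x) (τ K A A (ΔA b)) + lTensor A (tr x) (ΔA b)) ∧
  (∀ x b, ω K A (rTensor A (tr x) (ΔA b) - lTensor A (tl.flip x) (ΔA b)) = 0) ∧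
  -- H-bicomodule algebra
  (∀ a b, φ (mA a b) + τ K A H (ψ (mA b a))
      = lTensor H (mA a) (φ b) + lTensor H (mA.flip a) (τ K A H (ψ b))) ∧
  (∀ a b, lTensor H (mA.flip b) (φ a) - lTensor H (mA.flip a) (φ b)
      = τ K A H (rTensor H (mA a) (ψ b) - rTensor H (mA b) (ψ a))) ∧
  -- H-bicomodule coalgebra
  (∀ a, rTensor A φ (ΔA a) - α K H A A (lTensor H ΔA (φ a))
      = τ₁₃ K A A H (rTensor H ΔA (ψ a) - α K A A H (lTensor A ψ (ΔA a)))) ∧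
  (∀ a, rTensor A ψ (ΔA a) - α K A H A (lTensor A φ (ΔA a))
      = τ₁₃ K A H A (rTensor A ψ (ΔA a) - α K A H A (lTensor A φ (ΔA a)))) ∧
  -- (BB1)
  (∀ a b, ΔA (mA a b) + τ K A A (ΔA (mA b a))
      = rTensor A (mA.flip b) (ΔA a) + rTensor A (mA b) (τ K A A (ΔA a))
      + lTensor A (mA a) (ΔA b) + lTensor A (mA.flip a) (τ K A A (ΔA b))
      + rTensor A (tr.flip b) (φ a) + rTensor A (tl b) (τ K A H (ψ a))
      + lTensor A (tl a) (ψ b) + lTensor A (tr.flip a) (τ K H A (φ b))) ∧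
  -- (BB2)
  (∀ a b, ω K A (lTensor A (mA.flip b) (ΔA a) - rTensor A (mA b) (ΔA a)
        - lTensor A (mA.flip a) (ΔA b) + rTensor A (mA a) (ΔA b))
      + ω K A (lTensor A (tr.flip b) (ψ a) - rTensor A (tl b) (φ a)
        - lTensor A (tr.flip a) (ψ b) + rTensor A (tl a) (φ b)) = 0)

/-- The (cocycle) cross product multiplication on `A × H`:
`(a,x)(b,y) = (ab + x⇀b + a↼y + σ(x,y), xy + x◁b + a▷y + θ(a,b))`,
where `tr = ⇀`, `tl = ↼`, `sr = ▷`, `sl = ◁`. -/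
noncomputable def prodMul (mA : A →ₗ[K] A →ₗ[K] A) (mH : H →ₗ[K] H →ₗ[K] H)
    (tr : H →ₗ[K] A →ₗ[K] A) (tl : A →ₗ[K] H →ₗ[K] A)
    (sr : A →ₗ[K] H →ₗ[K] H) (sl : H →ₗ[K] A →ₗ[K] H)
    (σ : H →ₗ[K] H →ₗ[K] A) (θ : A →ₗ[K] A →ₗ[K] H) :
    (A × H) →ₗ[K] (A × H) →ₗ[K] (A × H) :=
  ((mA ∘ₗ fst K A H).compl₂ (fst K A H) + (tr ∘ₗ snd K A H).compl₂ (fst K A H)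
    + (tl ∘ₗ fst K A H).compl₂ (snd K A H)
    + (σ ∘ₗ snd K A H).compl₂ (snd K A H)).compr₂ (inl K A H)
  + ((mH ∘ₗ snd K A H).compl₂ (snd K A H) + (sl ∘ₗ snd K A H).compl₂ (fst K A H)
    + (sr ∘ₗ fst K A H).compl₂ (snd K A H)
    + (θ ∘ₗ fst K A H).compl₂ (fst K A H)).compr₂ (inr K A H)

/-- The (cycle) cross coproduct comultiplication on `A × H`:
`Δ(a) = Δ_A(a) + φ(a) + ψ(a) + P(a)` and `Δ(x) = Δ_H(x) + ρ(x) + γ(x) + Q(x)`. -/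
noncomputable def prodComul (ΔA : A →ₗ[K] A ⊗[K] A) (ΔH : H →ₗ[K] H ⊗[K] H)
    (φ : A →ₗ[K] H ⊗[K] A) (ψ : A →ₗ[K] A ⊗[K] H)
    (ρ : H →ₗ[K] A ⊗[K] H) (γ : H →ₗ[K] H ⊗[K] A)
    (P : A →ₗ[K] H ⊗[K] H) (Q : H →ₗ[K] A ⊗[K] A) :
    (A × H) →ₗ[K] (A × H) ⊗[K] (A × H) :=
  (TensorProduct.map (inl K A H) (inl K A H)) ∘ₗ ΔA ∘ₗ fst K A H
  + (TensorProduct.map (inr K A H) (inl K A H)) ∘ₗ φ ∘ₗ fst K A H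
  + (TensorProduct.map (inl K A H) (inr K A H)) ∘ₗ ψ ∘ₗ fst K A H
  + (TensorProduct.map (inr K A H) (inr K A H)) ∘ₗ P ∘ₗ fst K A H
  + (TensorProduct.map (inr K A H) (inr K A H)) ∘ₗ ΔH ∘ₗ snd K A H
  + (TensorProduct.map (inl K A H) (inr K A H)) ∘ₗ ρ ∘ₗ snd K A H
  + (TensorProduct.map (inr K A H) (inl K A H)) ∘ₗ γ ∘ₗ snd K A H
  + (TensorProduct.map (inl K A H) (inl K A H)) ∘ₗ Q ∘ₗ snd K A H

/-- The linear map `(a, x) ↦ (a + r(x), s(x))` on `A × V`. -/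
noncomputable def phiRS (r : V →ₗ[K] A) (s : V →ₗ[K] V) : (A × V) →ₗ[K] (A × V) :=
  (fst K A V + r ∘ₗ snd K A V).prod (s ∘ₗ snd K A V)

end Structures

end AntiFlexible

namespace AntiFlexible

section Naturality

variable {K : Type*} [Field K]
variable {M N P M' N' P' Q : Type*}
variable [AddCommGroup M] [Module K M] [AddCommGroup N] [Module K N] [AddCommGroup P] [Module K P]
variable [AddCommGroup M'] [Module K M'] [AddCommGroup N'] [Module K N']
variable [AddCommGroup P'] [Module K P'] [AddCommGroup Q] [Module K Q]

@[simp]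
lemma τ₁₃_τ₁₃ (t : (M ⊗[K] N) ⊗[K] P) : τ₁₃ K P N M (τ₁₃ K M N P t) = t := by
  have h : τ₁₃ K P N M ∘ₗ τ₁₃ K M N P = LinearMap.id := by
    ext m n p
    simp [τ₁₃, τ]
  exact LinearMap.congr_fun h t

lemma map_map_τ₁₃ (f : M →ₗ[K] M') (g : N →ₗ[K] N') (h : P →ₗ[K] P') (t : (M ⊗[K] N) ⊗[K] P) :
    TensorProduct.map (TensorProduct.map h g) f (τ₁₃ K M N P t) =
      τ₁₃ K M' N' P' (TensorProduct.map (TensorProduct.map f g) h t) := by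
  have e : TensorProduct.map (TensorProduct.map h g) f ∘ₗ τ₁₃ K M N P =
      τ₁₃ K M' N' P' ∘ₗ TensorProduct.map (TensorProduct.map f g) h := by
    ext m n p
    simp [τ₁₃, τ]
  exact LinearMap.congr_fun e t

lemma map_map_α (f : M →ₗ[K] M') (g : N →ₗ[K] N') (h : P →ₗ[K] P') (t : M ⊗[K] (N ⊗[K] P)) :
    α K M' N' P' (TensorProduct.map f (TensorProduct.map g h) t) =
      TensorProduct.map (TensorProduct.map f g) h (α K M N P t) := by
  have e : α K M' N' P' ∘ₗ TensorProduct.map f (TensorProduct.map g h) =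
      TensorProduct.map (TensorProduct.map f g) h ∘ₗ α K M N P := by
    ext m n p
    simp [α]
  exact LinearMap.congr_fun e t

lemma map_comp_left (u : M' →ₗ[K] N') (v : M →ₗ[K] M') (g : P →ₗ[K] Q) (t : M ⊗[K] P) :
    TensorProduct.map (u ∘ₗ v) g t = TensorProduct.map u g (rTensor P v t) := by
  rw [← LinearMap.comp_apply, map_comp_rTensor]

lemma map_comp_right (f : M →ₗ[K] M') (u : P' →ₗ[K] Q) (v : P →ₗ[K] P') (t : M ⊗[K] P) :
    TensorProduct.map f (u ∘ₗ v) t = TensorProduct.map f u (lTensor M v t) := by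
  rw [← LinearMap.comp_apply, map_comp_lTensor]

lemma rTensor_map_apply (u : M' →ₗ[K] N') (f : M →ₗ[K] M') (g : P →ₗ[K] P') (t : M ⊗[K] P) :
    rTensor P' u (TensorProduct.map f g t) = TensorProduct.map (u ∘ₗ f) g t := by
  rw [← LinearMap.comp_apply, rTensor_comp_map]

lemma lTensor_map_apply (u : P' →ₗ[K] Q) (f : M →ₗ[K] M') (g : P →ₗ[K] P') (t : M ⊗[K] P) :
    lTensor M' u (TensorProduct.map f g t) = TensorProduct.map f (u ∘ₗ g) t := by
  rw [← LinearMap.comp_apply, lTensor_comp_map]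

end Naturality

section Bicrossed

variable {K : Type*} [Field K]
variable {A H E : Type*}
variable [AddCommGroup A] [Module K A] [AddCommGroup H] [Module K H]
variable [AddCommGroup E] [Module K E]

/-- If `Δ` restricts along `i : A → E` and `j : H → E` to the bicrossed formulas, then half of the
matched pair conditions give the anti-flexible identity on the image of `i`. -/
lemma coassocDefect_eq_τ₁₃_of_bicrossed {Δ : E →ₗ[K] E ⊗[K] E} {i : A →ₗ[K] E} {j : H →ₗ[K] E}
    {ΔA : A →ₗ[K] A ⊗[K] A} {ΔH : H →ₗ[K] H ⊗[K] H}
    {φ : A →ₗ[K] H ⊗[K] A} {ψ : A →ₗ[K] A ⊗[K] H}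
    {ρ : H →ₗ[K] A ⊗[K] H} {γ : H →ₗ[K] H ⊗[K] A}
    (hi : Δ ∘ₗ i = TensorProduct.map i i ∘ₗ ΔA + TensorProduct.map j i ∘ₗ φ
      + TensorProduct.map i j ∘ₗ ψ)
    (hj : Δ ∘ₗ j = TensorProduct.map j j ∘ₗ ΔH + TensorProduct.map i j ∘ₗ ρ
      + TensorProduct.map j i ∘ₗ γ)
    (hA : IsAFCoalgebra ΔA) (hbicom : IsAFBicomodule ΔH φ ψ)
    (hHAA : ∀ a : A, rTensor A φ (ΔA a) + rTensor A γ (φ a) - α K H A A (lTensor H ΔA (φ a))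
      = τ₁₃ K A A H (rTensor H ΔA (ψ a) - α K A A H (lTensor A ψ (ΔA a))
        - α K A A H (lTensor A ρ (ψ a))))
    (hAHA : ∀ a : A, rTensor A ψ (ΔA a) + rTensor A ρ (φ a)
        - α K A H A (lTensor A φ (ΔA a)) - α K A H A (lTensor A γ (ψ a))
      = τ₁₃ K A H A (rTensor A ψ (ΔA a) + rTensor A ρ (φ a)
        - α K A H A (lTensor A φ (ΔA a)) - α K A H A (lTensor A γ (ψ a))))
    (a : A) :
    coassocDefect Δ (i a) = τ₁₃ K E E E (coassocDefect Δ (i a)) := by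
  have hia : Δ (i a) = TensorProduct.map i i (ΔA a) + TensorProduct.map j i (φ a)
      + TensorProduct.map i j (ψ a) := LinearMap.congr_fun hi a
  have hAAA := congrArg (TensorProduct.map (TensorProduct.map i i) i) (hA a)
  replace hHAA := congrArg (TensorProduct.map (TensorProduct.map j i) i) (hHAA a)
  replace hAHA := congrArg (TensorProduct.map (TensorProduct.map i j) i) (hAHA a)
  have hHHA := congrArg (TensorProduct.map (TensorProduct.map j j) i) (hbicom.1 a)
  have hHAH := congrArg (TensorProduct.map (TensorProduct.map j i) j) (hbicom.2 a)
  have hAAH := congrArg (τ₁₃ K E E E) hHAA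
  have hAHH := congrArg (τ₁₃ K E E E) hHHA
  simp only [coassocDefect, LinearMap.sub_apply, LinearMap.comp_apply, map_map_τ₁₃, τ₁₃_τ₁₃,
    map_add, map_sub] at hAAA hHAA hAHA hHHA hHAH hAAH hAHH
  simp only [coassocDefect, LinearMap.sub_apply, LinearMap.comp_apply, hia, map_add, map_sub,
    rTensor_map_apply, lTensor_map_apply, hi, hj, map_add_left, map_add_right,
    LinearMap.add_apply, map_comp_left, map_comp_right, map_map_α]
  linear_combination (norm := abel) hAAA + hHAA + hAHA + hHHA + hHAH - hAAH - hAHH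

end Bicrossed

end AntiFlexible

open AntiFlexible

/-- the bicrossed coproduct of a matched pair of anti-flexible
coalgebras is an anti-flexible coalgebra. -/
theorem bicrossed_coproduct_coalgebra
    (K A H : Type*) [Field K] [CharZero K]
    [AddCommGroup A] [Module K A] [AddCommGroup H] [Module K H]
    (ΔA : A →ₗ[K] A ⊗[K] A) (ΔH : H →ₗ[K] H ⊗[K] H)
    (φ : A →ₗ[K] H ⊗[K] A) (ψ : A →ₗ[K] A ⊗[K] H)
    (ρ : H →ₗ[K] A ⊗[K] H) (γ : H →ₗ[K] H ⊗[K] A)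
    (hA : IsAFCoalgebra ΔA) (hH : IsAFCoalgebra ΔH)
    (hHbicom : IsAFBicomodule ΔA ρ γ)
    (hAbicom : IsAFBicomodule ΔH φ ψ)
    -- (MC1)
    (hMC1 : ∀ a : A, rTensor A φ (ΔA a) + rTensor A γ (φ a)
        - α K H A A (lTensor H ΔA (φ a))
      = τ₁₃ K A A H (rTensor H ΔA (ψ a) - α K A A H (lTensor A ψ (ΔA a))
        - α K A A H (lTensor A ρ (ψ a))))
    -- (MC2)
    (hMC2 : ∀ a : A, rTensor A ψ (ΔA a) + rTensor A ρ (φ a)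
        - α K A H A (lTensor A φ (ΔA a)) - α K A H A (lTensor A γ (ψ a))
      = τ₁₃ K A H A (rTensor A ψ (ΔA a) + rTensor A ρ (φ a)
        - α K A H A (lTensor A φ (ΔA a)) - α K A H A (lTensor A γ (ψ a))))
    -- (MC3)
    (hMC3 : ∀ x : H, rTensor H ρ (ΔH x) + rTensor H ψ (ρ x)
        - α K A H H (lTensor A ΔH (ρ x))
      = τ₁₃ K H H A (rTensor A ΔH (γ x) - α K H H A (lTensor H φ (γ x))
        - α K H H A (lTensor H γ (ΔH x))))
    -- (MC4)
    (hMC4 : ∀ x : H, rTensor H γ (ΔH x) + rTensor H φ (ρ x)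
        - α K H A H (lTensor H ψ (γ x)) - α K H A H (lTensor H ρ (ΔH x))
      = τ₁₃ K H A H (rTensor H γ (ΔH x) + rTensor H φ (ρ x)
        - α K H A H (lTensor H ψ (γ x)) - α K H A H (lTensor H ρ (ΔH x))))
    :
    IsAFCoalgebra (prodComul ΔA ΔH φ ψ ρ γ 0 0) := by
  have hA_inl : prodComul ΔA ΔH φ ψ ρ γ 0 0 ∘ₗ inl K A H =
      TensorProduct.map (inl K A H) (inl K A H) ∘ₗ ΔA
      + TensorProduct.map (inr K A H) (inl K A H) ∘ₗ φ
      + TensorProduct.map (inl K A H) (inr K A H) ∘ₗ ψ := by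
    ext a
    simp [prodComul]
  have hH_inr : prodComul ΔA ΔH φ ψ ρ γ 0 0 ∘ₗ inr K A H =
      TensorProduct.map (inr K A H) (inr K A H) ∘ₗ ΔH
      + TensorProduct.map (inl K A H) (inr K A H) ∘ₗ ρ
      + TensorProduct.map (inr K A H) (inl K A H) ∘ₗ γ := by
    ext x
    simp [prodComul]
  rintro ⟨a, x⟩
  have hsplit : ((a, x) : A × H) = inl K A H a + inr K A H x := by simp
  rw [hsplit, map_add, map_add,
    ← coassocDefect_eq_τ₁₃_of_bicrossed hA_inl hH_inr hA hAbicom hMC1 hMC2 a,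
    ← coassocDefect_eq_τ₁₃_of_bicrossed hH_inr hA_inl hH hHbicom
      (fun x => by rw [hMC3 x, sub_right_comm])
      (fun x => by rw [sub_right_comm]; exact hMC4 x) x]
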